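/- For every s ∈ ℂ, ξ_-(s) = (1/2) · Σ_{n=0}^∞ (Σ_{r=n+1}^∞ (binomial(2r, 2n+1)·s − binomial(2r, 2n)) · ξ_r) · s^{2n}, and ξ_+(s) = (1/2) · (2·Σ_{n=0}^∞ ξ_n s^{2n} − Σ_{n=0}^∞ (Σ_{r=n+1}^∞ (binomial(2r, 2n+1)·s − binomial(2r, 2n)) · ξ_r) · s^{2n}), all series being convergent. -/

import Mathlib

open Complex

/-- The Riemann xi function: `ξ(s) = (s(s-1)/2)·Λ₀(s) + 1/2`. -/
noncomputable def xi (s : ℂ) : ℂ := s * (s - 1) / 2 * completedRiemannZeta₀ s + 1 / 2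

/-- `ξ_r = ξ^{(2r)}(1/2) / (2r)!`. -/
noncomputable def xiCoeff (r : ℕ) : ℂ := iteratedDeriv (2 * r) xi (1 / 2) / ((2 * r).factorial : ℂ)

/-- `ξ₊(s) = (1/2)(ξ(s+1/2) + ξ(s−1/2))`. -/
noncomputable def xiPlus (s : ℂ) : ℂ := (1 / 2) * (xi (s + 1 / 2) + xi (s - 1 / 2))

/-- `ξ₋(s) = (1/2)(ξ(s+1/2) − ξ(s−1/2))`. -/
noncomputable def xiMinus (s : ℂ) : ℂ := (1 / 2) * (xi (s + 1 / 2) - xi (s - 1 / 2))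

theorem Finset.sum_range_two_mul {M : Type*} [AddCommMonoid M] (h : ℕ → M) (n : ℕ) :
    ∑ k ∈ Finset.range (2 * n), h k = ∑ k ∈ Finset.range n, (h (2 * k) + h (2 * k + 1)) := by
  induction n with
  | zero => simp
  | succ n ih =>
    rw [Nat.mul_succ, Finset.sum_range_succ, Finset.sum_range_succ, Finset.sum_range_succ, ih,
      add_assoc]

/-- The binomial expansion of `x ^ (2m) - (x - 1) ^ (2m)`, with consecutive terms paired. -/
theorem sum_choose_mul_sub_choose_mul_pow {R : Type*} [CommRing R] (x : R) (m : ℕ) :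
    ∑ n ∈ Finset.range m,
      (((2 * m).choose (2 * n + 1) : R) * x - ((2 * m).choose (2 * n) : R)) * x ^ (2 * n) =
      x ^ (2 * m) - (x - 1) ^ (2 * m) := by
  have h := add_pow (-x) 1 (2 * m)
  rw [Finset.sum_range_succ, Finset.sum_range_two_mul] at h
  rw [← Even.neg_pow (even_two_mul m) (x - 1), neg_sub, sub_eq_neg_add 1 x, h,
    Even.neg_pow (even_two_mul m) x, one_pow, Nat.choose_self, Nat.cast_one, mul_one, mul_one,
    sub_add_cancel_right, ← Finset.sum_neg_distrib]
  refine Finset.sum_congr rfl fun n _ => ?_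
  rw [pow_succ, Even.neg_pow (even_two_mul n) x, one_pow, one_pow]
  ring

theorem sum_choose_mul_add_choose_mul_pow {R : Type*} [CommRing R] (x : R) (m : ℕ) :
    ∑ n ∈ Finset.range m,
      (((2 * m).choose (2 * n + 1) : R) * x + ((2 * m).choose (2 * n) : R)) * x ^ (2 * n) =
      (x + 1) ^ (2 * m) - x ^ (2 * m) := by
  have h := sum_choose_mul_sub_choose_mul_pow (-x) m
  rw [← neg_add', Even.neg_pow (even_two_mul m), Even.neg_pow (even_two_mul m)] at h
  rw [← neg_sub (x ^ (2 * m)), ← h, ← Finset.sum_neg_distrib]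
  refine Finset.sum_congr rfl fun n _ => ?_
  rw [Even.neg_pow (even_two_mul n)]
  ring

theorem xi_one_sub (s : ℂ) : xi (1 - s) = xi s := by
  simp only [xi, completedRiemannZeta₀_one_sub]
  ring

theorem differentiable_xi : Differentiable ℂ xi := by
  have := differentiable_completedZeta₀
  unfold xi
  fun_prop

theorem iteratedDeriv_odd_xi (n : ℕ) : iteratedDeriv (2 * n + 1) xi (1 / 2) = 0 := by
  have h := congrFun (iteratedDeriv_comp_const_sub (2 * n + 1) xi (1 : ℂ)) (1 / 2)
  simp only [xi_one_sub, Odd.neg_one_pow (odd_two_mul_add_one n), neg_smul, one_smul] at h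
  rw [show (1 : ℂ) - 1 / 2 = 1 / 2 by norm_num] at h
  exact self_eq_neg.mp h

/-- The Taylor expansion of `ξ` at the centre of the critical strip. -/
theorem hasSum_xiCoeff (z : ℂ) :
    HasSum (fun r : ℕ => xiCoeff r * z ^ (2 * r)) (xi (z + 1 / 2)) := by
  have h := Complex.hasSum_taylorSeries_of_entire differentiable_xi (1 / 2) (z + 1 / 2)
  rw [← (mul_right_injective₀ (two_ne_zero (α := ℕ))).hasSum_iff] at h
  · refine h.congr_fun fun r => ?_
    simp only [xiCoeff, Function.comp_apply, smul_eq_mul, add_sub_cancel_right]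
    ring
  · intro k hk
    obtain ⟨n, rfl | rfl⟩ := k.even_or_odd'
    · exact absurd ⟨n, rfl⟩ hk
    · simp [iteratedDeriv_odd_xi, -one_div]

theorem summable_choose_mul_add_choose_mul_norm_xiCoeff {t : ℝ} (ht : 0 ≤ t) :
    Summable (fun p : ℕ × ℕ =>
      (((2 * (p.1 + 1 + p.2)).choose (2 * p.1 + 1) : ℝ) * t +
        ((2 * (p.1 + 1 + p.2)).choose (2 * p.1) : ℝ)) * t ^ (2 * p.1) *
        ‖xiCoeff (p.1 + 1 + p.2)‖) := by
  rw [← Finset.HasAntidiagonal.sigmaAntidiagonalEquivProd.summable_iff,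
    summable_sigma_of_nonneg fun _ => by simp only [Function.comp_apply]; positivity]
  refine ⟨fun N => (hasSum_fintype _).summable, ?_⟩
  have key (u : ℝ) (hu : 0 ≤ u) :
      Summable fun N : ℕ => u ^ (2 * (N + 1)) * ‖xiCoeff (N + 1)‖ := by
    refine ((summable_nat_add_iff 1).mpr (hasSum_xiCoeff u).summable.norm).congr fun N => ?_
    rw [norm_mul, norm_pow, Complex.norm_real, Real.norm_of_nonneg hu, mul_comm]
  refine ((key (t + 1) (by positivity)).sub (key t ht)).congr fun N => ?_
  rw [← sub_mul, ← sum_choose_mul_add_choose_mul_pow, Finset.sum_mul, tsum_fintype,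
    Finset.univ_eq_attach]
  simp only [Function.comp_apply, Finset.HasAntidiagonal.sigmaAntidiagonalEquivProd_apply]
  rw [Finset.sum_attach (Finset.HasAntidiagonal.antidiagonal N) fun p : ℕ × ℕ =>
      (((2 * (p.1 + 1 + p.2)).choose (2 * p.1 + 1) : ℝ) * t +
        ((2 * (p.1 + 1 + p.2)).choose (2 * p.1) : ℝ)) * t ^ (2 * p.1) *
        ‖xiCoeff (p.1 + 1 + p.2)‖, Finset.Nat.sum_antidiagonal_eq_sum_range_succ_mk]
  refine Finset.sum_congr rfl fun n hn => ?_
  rw [show n + 1 + (N - n) = N + 1 by have := Finset.mem_range.mp hn; omega]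

theorem summable_choose_mul_sub_choose_mul_xiCoeff (s : ℂ) (n : ℕ) :
    Summable (fun r : ℕ =>
      (((2 * (n + 1 + r)).choose (2 * n + 1) : ℂ) * s -
        ((2 * (n + 1 + r)).choose (2 * n) : ℂ)) * xiCoeff (n + 1 + r)) := by
  have ht : 1 ≤ ‖s‖ + 1 := by linarith [norm_nonneg s]
  refine .of_norm_bounded ((summable_choose_mul_add_choose_mul_norm_xiCoeff
    (zero_le_one.trans ht)).prod_factor n) fun r => ?_
  rw [norm_mul]
  gcongr
  refine (norm_sub_le _ _).trans (le_trans ?_ (le_mul_of_one_le_right (by positivity)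
    (one_le_pow₀ ht)))
  simp only [norm_mul, Complex.norm_natCast]
  gcongr
  linarith

theorem hasSum_prod_choose_mul_xiCoeff (s : ℂ) :
    HasSum (fun p : ℕ × ℕ =>
      (((2 * (p.1 + 1 + p.2)).choose (2 * p.1 + 1) : ℂ) * s -
        ((2 * (p.1 + 1 + p.2)).choose (2 * p.1) : ℂ)) * xiCoeff (p.1 + 1 + p.2) * s ^ (2 * p.1))
      (xi (s + 1 / 2) - xi (s - 1 / 2)) := by
  have hs : Summable (fun p : ℕ × ℕ =>
      (((2 * (p.1 + 1 + p.2)).choose (2 * p.1 + 1) : ℂ) * s -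
        ((2 * (p.1 + 1 + p.2)).choose (2 * p.1) : ℂ)) * xiCoeff (p.1 + 1 + p.2) *
        s ^ (2 * p.1)) := by
    refine .of_norm_bounded (summable_choose_mul_add_choose_mul_norm_xiCoeff (norm_nonneg s))
      fun p => ?_
    rw [mul_right_comm, norm_mul, norm_mul, norm_pow]
    gcongr
    refine (norm_sub_le _ _).trans ?_
    simp only [norm_mul, Complex.norm_natCast, le_refl]
  have hd : HasSum (fun N : ℕ => (s ^ (2 * (N + 1)) - (s - 1) ^ (2 * (N + 1))) * xiCoeff (N + 1))
      (xi (s + 1 / 2) - xi (s - 1 / 2)) := by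
    have h := (hasSum_xiCoeff s).sub (hasSum_xiCoeff (s - 1))
    rw [show s - 1 + 1 / 2 = s - 1 / 2 by ring, ← hasSum_nat_add_iff' 1] at h
    simp only [Finset.sum_range_one, mul_zero, pow_zero, sub_self, sub_zero] at h
    exact h.congr_fun fun N => by ring
  rw [← Finset.HasAntidiagonal.sigmaAntidiagonalEquivProd.hasSum_iff]
  have hsig := (Finset.HasAntidiagonal.sigmaAntidiagonalEquivProd.summable_iff.mpr hs).hasSum
  convert hsig using 1
  refine hd.unique ?_
  convert hsig.sigma fun N => hasSum_fintype _ using 2 with N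
  rw [← sum_choose_mul_sub_choose_mul_pow, Finset.sum_mul, Finset.univ_eq_attach]
  simp only [Function.comp_apply, Finset.HasAntidiagonal.sigmaAntidiagonalEquivProd_apply]
  rw [Finset.sum_attach (Finset.HasAntidiagonal.antidiagonal N) fun p : ℕ × ℕ =>
      (((2 * (p.1 + 1 + p.2)).choose (2 * p.1 + 1) : ℂ) * s -
        ((2 * (p.1 + 1 + p.2)).choose (2 * p.1) : ℂ)) * xiCoeff (p.1 + 1 + p.2) * s ^ (2 * p.1),
    Finset.Nat.sum_antidiagonal_eq_sum_range_succ_mk]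
  refine Finset.sum_congr rfl fun n hn => ?_
  rw [show n + 1 + (N - n) = N + 1 by have := Finset.mem_range.mp hn; omega, mul_right_comm]

theorem hasSum_tsum_choose_mul_xiCoeff (s : ℂ) :
    HasSum (fun n : ℕ => (∑' r : ℕ,
      (((2 * (n + 1 + r)).choose (2 * n + 1) : ℂ) * s -
        ((2 * (n + 1 + r)).choose (2 * n) : ℂ)) * xiCoeff (n + 1 + r)) * s ^ (2 * n))
      (xi (s + 1 / 2) - xi (s - 1 / 2)) := by
  refine (hasSum_prod_choose_mul_xiCoeff s).prod_fiberwise fun n => ?_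
  exact (summable_choose_mul_sub_choose_mul_xiCoeff s n).hasSum.mul_right (s ^ (2 * n))

/-- Equations (19)–(20): the expansions of `ξ₋` and `ξ₊` in powers of `s`,
with inner sums over `r ≥ n + 1`, all series being convergent. -/
theorem xiPlus_xiMinus_expansions (s : ℂ) :
    (∀ n : ℕ, Summable (fun r : ℕ =>
      (((2 * (n + 1 + r)).choose (2 * n + 1) : ℂ) * s -
        ((2 * (n + 1 + r)).choose (2 * n) : ℂ)) * xiCoeff (n + 1 + r))) ∧
    Summable (fun n : ℕ => (∑' r : ℕ,
      (((2 * (n + 1 + r)).choose (2 * n + 1) : ℂ) * s -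
        ((2 * (n + 1 + r)).choose (2 * n) : ℂ)) * xiCoeff (n + 1 + r)) * s ^ (2 * n)) ∧
    Summable (fun n : ℕ => xiCoeff n * s ^ (2 * n)) ∧
    xiMinus s = (1 / 2) * ∑' n : ℕ, (∑' r : ℕ,
      (((2 * (n + 1 + r)).choose (2 * n + 1) : ℂ) * s -
        ((2 * (n + 1 + r)).choose (2 * n) : ℂ)) * xiCoeff (n + 1 + r)) * s ^ (2 * n) ∧
    xiPlus s = (1 / 2) * (2 * (∑' n : ℕ, xiCoeff n * s ^ (2 * n)) -
      ∑' n : ℕ, (∑' r : ℕ,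
      (((2 * (n + 1 + r)).choose (2 * n + 1) : ℂ) * s -
        ((2 * (n + 1 + r)).choose (2 * n) : ℂ)) * xiCoeff (n + 1 + r)) * s ^ (2 * n)) := by
  have h := hasSum_tsum_choose_mul_xiCoeff s
  have hx := hasSum_xiCoeff s
  refine ⟨summable_choose_mul_sub_choose_mul_xiCoeff s, h.summable, hx.summable, ?_, ?_⟩
  · rw [h.tsum_eq, xiMinus]
  · rw [h.tsum_eq, hx.tsum_eq, xiPlus]
    ring
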